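/- Let D be a finite set of N players. Suppose ψ is a map assigning to every utility function U (mapping subsets of D to ℝ, with U(∅) = 0) a vector (ψ_z(U))_{z ∈ D} of real numbers, such that ψ satisfies: (i) null player: if U(S ∪ {z}) = U(S) for all S ⊆ D∖{z} then ψ_z(U) = 0; (ii) symmetry: if U(S ∪ {z_i}) = U(S ∪ {z_j}) for all S ⊆ D∖{z_i, z_j} then ψ_{z_i}(U) = ψ_{z_j}(U); (iii) linearity: ψ_z(α₁U₁ + α₂U₂) = α₁ψ_z(U₁) + α₂ψ_z(U₂) for all α₁, α₂ ∈ ℝ; and (iv) efficiency: Σ_{z ∈ D} ψ_z(U) = U(D). Then ψ coincides with the Shapley value: ψ_z(U) = φ_z(U) for every such U and every z ∈ D. -/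

import Mathlib

open Finset

/-- The Shapley value of player `z` in the game with finite player set `D` and
utility function `U`. -/
noncomputable def shapley {α : Type*} [DecidableEq α]
    (D : Finset α) (U : Finset α → ℝ) (z : α) : ℝ :=
  ((D.card : ℝ))⁻¹ * ∑ k ∈ Finset.Icc 1 D.card,
    (((D.card - 1).choose (k - 1) : ℝ))⁻¹ *
      ∑ S ∈ (D \ {z}).powersetCard (k - 1), (U (S ∪ {z}) - U S)

/-- The null player, symmetry, linearity and efficiency axioms for a value notion on games with
player set `D`. -/
structure IsShapleyValue {α : Type*} [DecidableEq α] (D : Finset α)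
    (ψ : (Finset α → ℝ) → α → ℝ) : Prop where
  null : ∀ U : Finset α → ℝ, U ∅ = 0 → ∀ z ∈ D,
    (∀ S : Finset α, S ⊆ D \ {z} → U (S ∪ {z}) = U S) → ψ U z = 0
  symmetric : ∀ U : Finset α → ℝ, U ∅ = 0 → ∀ zi ∈ D, ∀ zj ∈ D, zi ≠ zj →
    (∀ S : Finset α, S ⊆ D \ {zi, zj} → U (S ∪ {zi}) = U (S ∪ {zj})) → ψ U zi = ψ U zj
  linear : ∀ U₁ U₂ : Finset α → ℝ, U₁ ∅ = 0 → U₂ ∅ = 0 → ∀ α₁ α₂ : ℝ, ∀ z ∈ D,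
    ψ (fun S => α₁ * U₁ S + α₂ * U₂ S) z = α₁ * ψ U₁ z + α₂ * ψ U₂ z
  efficient : ∀ U : Finset α → ℝ, U ∅ = 0 → ∑ z ∈ D, ψ U z = U D

section Shapley

variable {α : Type*} [DecidableEq α] {D : Finset α}

/-- The unanimity game of the coalition `T`. -/
def unanimityGame (T S : Finset α) : ℝ := if T ⊆ S then 1 else 0

lemma unanimityGame_empty {T : Finset α} (hT : T.Nonempty) : unanimityGame T ∅ = 0 := by
  simp [unanimityGame, hT.ne_empty]

namespace IsShapleyValue

variable {ψ χ : (Finset α → ℝ) → α → ℝ}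

lemma apply_unanimityGame (h : IsShapleyValue D ψ) {T : Finset α} (hT : T.Nonempty)
    (hTD : T ⊆ D) {z : α} (hz : z ∈ D) :
    ψ (unanimityGame T) z = if z ∈ T then (T.card : ℝ)⁻¹ else 0 := by
  have h0 := unanimityGame_empty hT
  have hout : ∀ x ∈ D, x ∉ T → ψ (unanimityGame T) x = 0 := fun x hx hxT =>
    h.null _ h0 x hx fun S _ => by
      have : T ⊆ S ∪ {x} ↔ T ⊆ S := by
        rw [union_singleton, subset_insert_iff_of_notMem hxT]
      simp only [unanimityGame, this]
  split_ifs with hzT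
  · have hin : ∀ x ∈ T, ψ (unanimityGame T) x = ψ (unanimityGame T) z := by
      intro x hx
      by_cases hxz : x = z
      · rw [hxz]
      refine h.symmetric _ h0 x (hTD hx) z hz hxz fun S hS => ?_
      have hxS : x ∉ S := fun hmem => by simpa using hS hmem
      have hzS : z ∉ S := fun hmem => by simpa using hS hmem
      have h₁ : ¬ T ⊆ S ∪ {x} := fun hsub => by
        have := hsub hzT
        simp_all
      have h₂ : ¬ T ⊆ S ∪ {z} := fun hsub => by
        have := hsub hx
        simp_all
      simp only [unanimityGame, if_neg h₁, if_neg h₂]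
    have hsum := h.efficient _ h0
    rw [← sum_subset hTD fun x hx hxT => hout x hx hxT, sum_congr rfl hin, sum_const,
      nsmul_eq_mul] at hsum
    simp only [unanimityGame, if_pos hTD] at hsum
    exact eq_inv_of_mul_eq_one_right hsum
  · exact hout z hz hzT

lemma eq_zero_of_forall_subset (h : IsShapleyValue D ψ) {U : Finset α → ℝ}
    (hU : ∀ S ⊆ D, U S = 0) {z : α} (hz : z ∈ D) : ψ U z = 0 :=
  h.null U (hU ∅ (empty_subset D)) z hz fun S hS => by
    have hSD : S ⊆ D := hS.trans sdiff_subset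
    rw [hU S hSD, hU _ (union_subset hSD (singleton_subset_iff.2 hz))]

lemma apply_sum (h : IsShapleyValue D ψ) {ι : Type*} (s : Finset ι) (c : ι → ℝ)
    (V : ι → Finset α → ℝ) (hV : ∀ i ∈ s, V i ∅ = 0) {z : α} (hz : z ∈ D) :
    ψ (fun S => ∑ i ∈ s, c i * V i S) z = ∑ i ∈ s, c i * ψ (V i) z := by
  classical
  induction s using Finset.induction_on with
  | empty => exact h.eq_zero_of_forall_subset (by simp) hz
  | insert i s hi ih =>
    have hs : ∀ j ∈ s, V j ∅ = 0 := fun j hj => hV j (mem_insert_of_mem hj)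
    have := h.linear (V i) (fun S => ∑ j ∈ s, c j * V j S) (hV i (mem_insert_self i s))
      (sum_eq_zero fun j hj => by rw [hs j hj, mul_zero]) (c i) 1 z hz
    simpa only [sum_insert hi, one_mul, ih hs] using this

lemma unique_of_card_lt (hψ : IsShapleyValue D ψ) (hχ : IsShapleyValue D χ) {z : α}
    (hz : z ∈ D) (m k : ℕ) (hk : D.card ≤ k + m) (U : Finset α → ℝ)
    (hU : ∀ S ⊆ D, S.card ≤ k → U S = 0) : ψ U z = χ U z := by
  induction m generalizing k U with
  | zero =>
    have hU' : ∀ S ⊆ D, U S = 0 := fun S hS => hU S hS ((card_le_card hS).trans hk)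
    rw [hψ.eq_zero_of_forall_subset hU' hz, hχ.eq_zero_of_forall_subset hU' hz]
  | succ m ih =>
    let W : Finset α → ℝ := fun S => ∑ T ∈ D.powersetCard (k + 1), U T * unanimityGame T S
    have hne : ∀ T ∈ D.powersetCard (k + 1), T.Nonempty := fun T hT =>
      card_pos.1 (by rw [(mem_powersetCard.1 hT).2]; exact k.succ_pos)
    have hV : ∀ T ∈ D.powersetCard (k + 1), unanimityGame T ∅ = 0 := fun T hT =>
      unanimityGame_empty (hne T hT)
    have hW0 : W ∅ = 0 := sum_eq_zero fun T hT => by rw [hV T hT, mul_zero]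
    have hU0 : U ∅ = 0 := hU ∅ (empty_subset D) (by simp)
    have hW : ψ W z = χ W z := by
      rw [hψ.apply_sum _ _ _ hV hz, hχ.apply_sum _ _ _ hV hz]
      refine sum_congr rfl fun T hT => ?_
      have hTD := (mem_powersetCard.1 hT).1
      rw [hψ.apply_unanimityGame (hne T hT) hTD hz, hχ.apply_unanimityGame (hne T hT) hTD hz]
    have hdiff := ih (k + 1) (by omega) (fun S => 1 * U S + (-1) * W S) fun S hSD hS => by
      have hWS : W S = U S := by
        rcases hS.lt_or_eq with hlt | heq
        · rw [hU S hSD (by omega)]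
          refine sum_eq_zero fun T hT => ?_
          have : ¬ T ⊆ S := fun hTS => by
            have := card_le_card hTS
            rw [(mem_powersetCard.1 hT).2] at this
            omega
          simp [unanimityGame, this]
        · refine (sum_eq_single S (fun T hT hTS => ?_) fun hS' => ?_).trans ?_
          · have : ¬ T ⊆ S := fun hsub =>
              hTS (eq_of_subset_of_card_le hsub (by rw [heq, (mem_powersetCard.1 hT).2]))
            simp [unanimityGame, this]
          · exact absurd (mem_powersetCard.2 ⟨hSD, heq⟩) hS'
          · simp [unanimityGame]
      rw [hWS]
      ring
    rw [hψ.linear U W hU0 hW0 _ _ z hz, hχ.linear U W hU0 hW0 _ _ z hz, hW] at hdiff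
    linarith

theorem unique (hψ : IsShapleyValue D ψ) (hχ : IsShapleyValue D χ) {U : Finset α → ℝ}
    (hU : U ∅ = 0) {z : α} (hz : z ∈ D) : ψ U z = χ U z :=
  hψ.unique_of_card_lt hχ hz D.card 0 (by simp) U fun S _ hS => by
    rwa [card_eq_zero.1 (Nat.le_zero.1 hS)]

end IsShapleyValue

lemma sum_powersetCard_sdiff_singleton (f : Finset α → ℝ) (k : ℕ) :
    ∑ z ∈ D, ∑ S ∈ (D \ {z}).powersetCard k, f S =
      ((D.card - k : ℕ) : ℝ) * ∑ S ∈ D.powersetCard k, f S := by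
  rw [sum_comm' (t' := D.powersetCard k) (s' := fun S => D \ S)]
  · rw [mul_sum]
    refine sum_congr rfl fun S hS => ?_
    obtain ⟨hSD, hS⟩ := mem_powersetCard.1 hS
    rw [sum_const, card_sdiff_of_subset hSD, hS, nsmul_eq_mul]
  · intro z S
    simp only [mem_powersetCard, mem_sdiff, subset_sdiff, disjoint_singleton_right]
    tauto

lemma sum_powersetCard_union_singleton (f : Finset α → ℝ) (k : ℕ) :
    ∑ z ∈ D, ∑ S ∈ (D \ {z}).powersetCard k, f (S ∪ {z}) =
      ((k + 1 : ℕ) : ℝ) * ∑ T ∈ D.powersetCard (k + 1), f T := by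
  have hinner : ∀ z ∈ D, ∑ S ∈ (D \ {z}).powersetCard k, f (S ∪ {z}) =
      ∑ T ∈ D.powersetCard (k + 1) with z ∈ T, f T := by
    intro z hz
    refine sum_bij' (fun S _ => S ∪ {z}) (fun T _ => T \ {z}) ?_ ?_ ?_ ?_ fun _ _ => rfl
    · intro S hS
      obtain ⟨hSD, hS⟩ := mem_powersetCard.1 hS
      obtain ⟨hSD, hzS⟩ := subset_sdiff.1 hSD
      simp only [mem_filter, mem_powersetCard, card_union_of_disjoint hzS, hS, card_singleton]
      exact ⟨⟨union_subset hSD (singleton_subset_iff.2 hz), trivial⟩, by simp⟩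
    · intro T hT
      obtain ⟨hT, hzT⟩ := mem_filter.1 hT
      obtain ⟨hTD, hT⟩ := mem_powersetCard.1 hT
      rw [mem_powersetCard, card_sdiff_of_subset (singleton_subset_iff.2 hzT), hT]
      exact ⟨sdiff_subset_sdiff hTD Subset.rfl, by simp⟩
    · intro S hS
      have hzS := (subset_sdiff.1 (mem_powersetCard.1 hS).1).2
      exact union_sdiff_cancel_right hzS
    · intro T hT
      exact sdiff_union_of_subset (singleton_subset_iff.2 (mem_filter.1 hT).2)
  rw [sum_congr rfl hinner, sum_comm' (t' := D.powersetCard (k + 1)) (s' := fun T => T)]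
  · rw [mul_sum]
    refine sum_congr rfl fun T hT => ?_
    rw [sum_const, (mem_powersetCard.1 hT).2, nsmul_eq_mul]
  · intro z T
    simp only [mem_filter, mem_powersetCard]
    constructor
    · tauto
    · rintro ⟨hzT, hTD, hT⟩
      exact ⟨hTD hzT, ⟨hTD, hT⟩, hzT⟩

lemma shapley_eq_sum_range (U : Finset α → ℝ) (z : α) :
    shapley D U z = (D.card : ℝ)⁻¹ * ∑ k ∈ range D.card, ((D.card - 1).choose k : ℝ)⁻¹ *
      ∑ S ∈ (D \ {z}).powersetCard k, (U (S ∪ {z}) - U S) := by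
  rw [shapley, range_eq_Ico, ← sum_Ico_add_right_sub_eq (c := 1)]
  rfl

lemma sum_shapley (U : Finset α → ℝ) : ∑ z ∈ D, shapley D U z = U D - U ∅ := by
  let A : ℕ → ℝ := fun k => (D.card.choose k : ℝ)⁻¹ * ∑ S ∈ D.powersetCard k, U S
  have hA : ∀ k ∈ range D.card, (D.card : ℝ)⁻¹ * (((D.card - 1).choose k : ℝ)⁻¹ *
      ∑ z ∈ D, ∑ S ∈ (D \ {z}).powersetCard k, (U (S ∪ {z}) - U S)) = A (k + 1) - A k := by
    intro k hk
    have hk := mem_range.1 hk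
    obtain ⟨n, hn⟩ : ∃ n, D.card = n + 1 := ⟨D.card - 1, by omega⟩
    simp only [sum_sub_distrib]
    rw [sum_powersetCard_union_singleton, sum_powersetCard_sdiff_singleton]
    simp only [A, hn, Nat.add_sub_cancel]
    have h₁ : ((n + 1 : ℕ) : ℝ) * (n.choose k : ℝ) = ((n + 1).choose (k + 1) : ℝ) * (k + 1 : ℕ) := by
      exact_mod_cast Nat.add_one_mul_choose_eq n k
    have h₂ : (n.choose k : ℝ) * (n + 1 : ℕ) = ((n + 1).choose k : ℝ) * (n + 1 - k : ℕ) := by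
      exact_mod_cast Nat.choose_mul_succ_eq n k
    have p₀ : (n.choose k : ℝ) ≠ 0 := by
      exact_mod_cast (Nat.choose_pos (by omega)).ne'
    have p₁ : ((n + 1).choose (k + 1) : ℝ) ≠ 0 := by
      exact_mod_cast (Nat.choose_pos (by omega)).ne'
    have p₂ : ((n + 1).choose k : ℝ) ≠ 0 := by
      exact_mod_cast (Nat.choose_pos (by omega)).ne'
    have p₃ : ((n + 1 : ℕ) : ℝ) ≠ 0 := by exact_mod_cast n.succ_ne_zero
    have e₁ : ((n + 1 : ℕ) : ℝ)⁻¹ * (n.choose k : ℝ)⁻¹ * (k + 1 : ℕ) =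
        ((n + 1).choose (k + 1) : ℝ)⁻¹ := by
      rw [← mul_inv, h₁, mul_inv, mul_assoc, inv_mul_cancel₀ (by positivity), mul_one]
    have e₂ : ((n + 1 : ℕ) : ℝ)⁻¹ * (n.choose k : ℝ)⁻¹ * (n + 1 - k : ℕ) =
        ((n + 1).choose k : ℝ)⁻¹ := by
      have p₄ : ((n + 1 - k : ℕ) : ℝ) ≠ 0 := by
        exact_mod_cast (by omega : n + 1 - k ≠ 0)
      rw [← mul_inv, mul_comm _ (n.choose k : ℝ), h₂, mul_inv, mul_assoc, inv_mul_cancel₀ p₄,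
        mul_one]
    rw [← e₁, ← e₂]
    ring
  simp only [shapley_eq_sum_range]
  rw [← mul_sum, sum_comm]
  simp only [← mul_sum]
  rw [mul_sum, sum_congr rfl hA, sum_range_sub]
  simp [A]

lemma apply_map_swap {U : Finset α → ℝ} {a b : α}
    (hU : ∀ S : Finset α, S ⊆ D \ {a, b} → U (S ∪ {a}) = U (S ∪ {b}))
    {S : Finset α} (hS : S ⊆ D) : U (S.map (Equiv.swap a b).toEmbedding) = U S := by
  have hR : S \ {a, b} ⊆ D \ {a, b} := sdiff_subset_sdiff hS Subset.rfl
  by_cases haS : a ∈ S <;> by_cases hbS : b ∈ S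
  · congr 1
    ext x
    rw [mem_map_equiv, Equiv.symm_swap, Equiv.swap_apply_def]
    split_ifs <;> simp_all
  · rw [show S.map (Equiv.swap a b).toEmbedding = S \ {a, b} ∪ {b} by
      ext x
      rw [mem_map_equiv, Equiv.symm_swap, Equiv.swap_apply_def]
      split_ifs <;> grind, ← hU _ hR]
    congr 1
    grind
  · rw [show S.map (Equiv.swap a b).toEmbedding = S \ {a, b} ∪ {a} by
      ext x
      rw [mem_map_equiv, Equiv.symm_swap, Equiv.swap_apply_def]
      split_ifs <;> simp_all, hU _ hR]
    congr 1
    grind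
  · congr 1
    ext x
    rw [mem_map_equiv, Equiv.symm_swap, Equiv.swap_apply_def]
    split_ifs <;> simp_all

lemma shapley_eq_of_symmetric {U : Finset α → ℝ} {a b : α} (ha : a ∈ D) (hb : b ∈ D)
    (hU : ∀ S : Finset α, S ⊆ D \ {a, b} → U (S ∪ {a}) = U (S ∪ {b})) :
    shapley D U a = shapley D U b := by
  have hmap : (D \ {a}).map (Equiv.swap a b).toEmbedding = D \ {b} := by
    ext x
    rw [mem_map_equiv, Equiv.symm_swap, Equiv.swap_apply_def]
    grind
  simp only [shapley]
  congr 1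
  refine sum_congr rfl fun k _ => ?_
  congr 1
  rw [← hmap, powersetCard_map, sum_map]
  refine sum_congr rfl fun S hS => ?_
  have hSD : S ⊆ D := (mem_powersetCard.1 hS).1.trans sdiff_subset
  have hSa : S ∪ {a} ⊆ D := union_subset hSD (singleton_subset_iff.2 ha)
  have h₁ := apply_map_swap hU hSD
  have h₂ := apply_map_swap hU hSa
  rw [map_union, map_singleton, Equiv.coe_toEmbedding, Equiv.swap_apply_left] at h₂
  simp only [mapEmbedding_apply, RelEmbedding.coe_toEmbedding]
  rw [h₁, h₂]

theorem isShapleyValue_shapley (D : Finset α) : IsShapleyValue D (shapley D) where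
  null U _ z _ h := by
    rw [shapley]
    refine mul_eq_zero_of_right _ (sum_eq_zero fun k _ => mul_eq_zero_of_right _ ?_)
    exact sum_eq_zero fun S hS => sub_eq_zero.2 (h S (mem_powersetCard.1 hS).1)
  symmetric _ _ _ ha _ hb _ h := shapley_eq_of_symmetric ha hb h
  linear U₁ U₂ _ _ c₁ c₂ z _ := by
    simp only [shapley, mul_sum, ← sum_add_distrib]
    refine sum_congr rfl fun k _ => sum_congr rfl fun S _ => ?_
    ring
  efficient U hU := by rw [sum_shapley, hU, sub_zero]

end Shapley

/-- **Uniqueness of the Shapley value** (Shapley, 1953). Any value notion `ψ` on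
utility functions with `U(∅) = 0` satisfying the null player, symmetry, linearity,
and efficiency axioms coincides with the Shapley value. -/
theorem shapley_uniqueness {α : Type*} [DecidableEq α]
    (D : Finset α) (ψ : (Finset α → ℝ) → α → ℝ)
    (hnull : ∀ U : Finset α → ℝ, U ∅ = 0 → ∀ z ∈ D,
      (∀ S : Finset α, S ⊆ D \ {z} → U (S ∪ {z}) = U S) → ψ U z = 0)
    (hsym : ∀ U : Finset α → ℝ, U ∅ = 0 → ∀ zi ∈ D, ∀ zj ∈ D, zi ≠ zj →
      (∀ S : Finset α, S ⊆ D \ {zi, zj} → U (S ∪ {zi}) = U (S ∪ {zj})) →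
      ψ U zi = ψ U zj)
    (hlin : ∀ U₁ U₂ : Finset α → ℝ, U₁ ∅ = 0 → U₂ ∅ = 0 → ∀ α₁ α₂ : ℝ, ∀ z ∈ D,
      ψ (fun S => α₁ * U₁ S + α₂ * U₂ S) z = α₁ * ψ U₁ z + α₂ * ψ U₂ z)
    (heff : ∀ U : Finset α → ℝ, U ∅ = 0 → ∑ z ∈ D, ψ U z = U D) :
    ∀ U : Finset α → ℝ, U ∅ = 0 → ∀ z ∈ D, ψ U z = shapley D U z := by
  intro U hU z hz
  exact IsShapleyValue.unique ⟨hnull, hsym, hlin, heff⟩ (isShapleyValue_shapley D) hU hz
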